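/- For every integer k ≥ 4, if A is a uniformly random symmetric k×k matrix over F₂ and A_{k−1} denotes its top-left (k−1)×(k−1) submatrix, then Pr[rank(A_{k−1}) ≤ k−3] ≥ 2^{−6}. -/

import Mathlib

open scoped Classical
open Matrix

noncomputable section

/-- `f : 𝔽₂ⁿ → 𝔽₂` has degree at most `d` (as a multilinear polynomial). -/
def degLE (n d : ℕ) (f : (Fin n → ZMod 2) → ZMod 2) : Prop :=
  ∃ p : MvPolynomial (Fin n) (ZMod 2), p.totalDegree ≤ d ∧ ∀ x, MvPolynomial.eval x p = f x

/-- fractional Hamming distance between two functions on 𝔽₂ⁿ. -/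
def hdist (n : ℕ) (f g : (Fin n → ZMod 2) → ZMod 2) : ℝ :=
  ((Finset.univ.filter fun x => f x ≠ g x).card : ℝ) / 2 ^ n

/-- distance of `f` to the Reed–Muller code RM(d,n). -/
def deltaD (n d : ℕ) (f : (Fin n → ZMod 2) → ZMod 2) : ℝ :=
  sInf {r : ℝ | ∃ g, degLE n d g ∧ r = hdist n f g}

/-- Rejection probability of the `k`-flat test: a uniformly random `k`-flat is chosen
(via a uniformly random injective affine parametrization `u ↦ M u + b`), and the test
rejects iff the restriction of `f` does not have degree at most `d`. -/
def Rej (n d k : ℕ) (f : (Fin n → ZMod 2) → ZMod 2) : ℝ :=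
  ((Finset.univ.filter fun Mb : Matrix (Fin n) (Fin k) (ZMod 2) × (Fin n → ZMod 2) =>
      Function.Injective Mb.1.mulVec ∧
        ¬ degLE k d (fun u => f (Mb.1.mulVec u + Mb.2))).card : ℝ) /
  ((Finset.univ.filter fun Mb : Matrix (Fin n) (Fin k) (ZMod 2) × (Fin n → ZMod 2) =>
      Function.Injective Mb.1.mulVec).card : ℝ)

/-- Rejection probability of the (d+1)-fold derivative (Gowers norm) test. -/
def Rej0 (n d : ℕ) (f : (Fin n → ZMod 2) → ZMod 2) : ℝ :=
  ((Finset.univ.filter fun xa : (Fin n → ZMod 2) × (Fin (d+1) → Fin n → ZMod 2) =>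
      (∑ S : Finset (Fin (d+1)), f (xa.1 + ∑ i ∈ S, xa.2 i)) = 1).card : ℝ) /
  ((2 ^ n) * (2 ^ n) ^ (d+1) : ℝ)

/-- the (d+1)-st Gowers norm of `f`. -/
def gowersNorm (n d : ℕ) (f : (Fin n → ZMod 2) → ZMod 2) : ℝ :=
  (1 - 2 * Rej0 n d f) ^ ((1 : ℝ) / 2 ^ (d+1))

/-- t-fold XOR of `f`, as a function on 𝔽₂^(t·n). -/
def xorPow (n t : ℕ) (f : (Fin n → ZMod 2) → ZMod 2) :
    (Fin (t * n) → ZMod 2) → ZMod 2 :=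
  fun x => ∑ i : Fin t, f fun j => x (finProdFinEquiv (i, j))

/-- elementary symmetric polynomial of degree m on n variables over 𝔽₂. -/
def symPoly (n m : ℕ) : (Fin n → ZMod 2) → ZMod 2 :=
  fun x => ∑ I ∈ Finset.powersetCard m Finset.univ, ∏ i ∈ I, x i

/-- the hyperplane `{x : L·x = b}`. -/
def hyp (n : ℕ) (L : Fin n → ZMod 2) (b : ZMod 2) : Set (Fin n → ZMod 2) :=
  {x | ∑ i, L i * x i = b}


lemma matrix_rank_add_le {m n K : Type*} [Fintype m] [Fintype n] [Field K] (A B : Matrix m n K) :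
    (A + B).rank ≤ A.rank + B.rank := by
  rw [Matrix.rank, Matrix.mulVecLin_add]
  refine (Submodule.finrank_mono ?_).trans (Submodule.finrank_add_le_finrank_add_finrank
    (LinearMap.range A.mulVecLin) (LinearMap.range B.mulVecLin))
  rintro _ ⟨x, rfl⟩
  exact Submodule.add_mem_sup ⟨x, rfl⟩ ⟨x, rfl⟩

/-- The square matrix obtained from `B` by appending the column `c`, the row `c` and the corner
entry `d`. -/
def borderMatrix {n : ℕ} (B : Matrix (Fin n) (Fin n) (ZMod 2)) (c : Fin n → ZMod 2) (d : ZMod 2) :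
    Matrix (Fin (n + 1)) (Fin (n + 1)) (ZMod 2) :=
  Matrix.of (Fin.snoc (α := fun _ => Fin (n + 1) → ZMod 2)
    (fun i => Fin.snoc (α := fun _ => ZMod 2) (B i) (c i)) (Fin.snoc (α := fun _ => ZMod 2) c d))

section borderMatrix

variable {n : ℕ} (B : Matrix (Fin n) (Fin n) (ZMod 2)) (c : Fin n → ZMod 2) (d : ZMod 2)

@[simp] lemma borderMatrix_castSucc_castSucc (i j : Fin n) :
    borderMatrix B c d i.castSucc j.castSucc = B i j := by simp [borderMatrix]

@[simp] lemma borderMatrix_castSucc_last (i : Fin n) :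
    borderMatrix B c d i.castSucc (Fin.last n) = c i := by simp [borderMatrix]

@[simp] lemma borderMatrix_last_castSucc (j : Fin n) :
    borderMatrix B c d (Fin.last n) j.castSucc = c j := by simp [borderMatrix]

@[simp] lemma borderMatrix_last_last :
    borderMatrix B c d (Fin.last n) (Fin.last n) = d := by simp [borderMatrix]

lemma borderMatrix_submatrix_castSucc :
    (borderMatrix B c d).submatrix Fin.castSucc Fin.castSucc = B := by
  ext i j; simp

/-- The `n × (n + 1)` matrix consisting of the identity followed by the column `x`. -/
def identityAppend (x : Fin n → ZMod 2) : Matrix (Fin n) (Fin (n + 1)) (ZMod 2) :=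
  Matrix.of fun i => Fin.snoc (α := fun _ => ZMod 2) ((1 : Matrix (Fin n) (Fin n) (ZMod 2)) i) (x i)

lemma mul_identityAppend_castSucc {m : ℕ} (M : Matrix (Fin m) (Fin n) (ZMod 2))
    (x : Fin n → ZMod 2) (i : Fin m) (j : Fin n) :
    (M * identityAppend x) i j.castSucc = M i j := by
  simp [Matrix.mul_apply, identityAppend, Matrix.one_apply]

lemma mul_identityAppend_last {m : ℕ} (M : Matrix (Fin m) (Fin n) (ZMod 2))
    (x : Fin n → ZMod 2) (i : Fin m) :
    (M * identityAppend x) i (Fin.last n) = (M *ᵥ x) i := by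
  simp [Matrix.mul_apply, identityAppend, Matrix.mulVec, dotProduct]

lemma borderMatrix_mulVec_eq (hB : B = Bᵀ) (x : Fin n → ZMod 2) :
    borderMatrix B (B *ᵥ x) (x ⬝ᵥ B *ᵥ x) = (identityAppend x)ᵀ * (B * identityAppend x) := by
  rw [← Matrix.transpose_transpose ((identityAppend x)ᵀ * (B * identityAppend x)),
    Matrix.transpose_mul, Matrix.transpose_transpose]
  ext i j
  rw [Matrix.transpose_apply]
  have key (a : Fin n) : (B * identityAppend x)ᵀ (Fin.last n) a = (B *ᵥ x) a := by
    rw [Matrix.transpose_apply, mul_identityAppend_last]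
  have key' (a b : Fin n) : (B * identityAppend x)ᵀ b.castSucc a = B a b := by
    rw [Matrix.transpose_apply, mul_identityAppend_castSucc]
  refine Fin.lastCases ?_ (fun i => ?_) i <;> refine Fin.lastCases ?_ (fun j => ?_) j
  · rw [mul_identityAppend_last, borderMatrix_last_last, Matrix.mulVec, dotProduct_comm]
    simp only [dotProduct, key]
  · rw [mul_identityAppend_last, borderMatrix_last_castSucc]
    simp only [Matrix.mulVec, dotProduct, key']
    exact Finset.sum_congr rfl fun a _ => by rw [hB, Matrix.transpose_apply, ← hB]
  · rw [mul_identityAppend_castSucc, borderMatrix_castSucc_last, key]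
  · rw [mul_identityAppend_castSucc, borderMatrix_castSucc_castSucc, key']

lemma rank_borderMatrix_mulVec_le (hB : B = Bᵀ) (x : Fin n → ZMod 2) :
    (borderMatrix B (B *ᵥ x) (x ⬝ᵥ B *ᵥ x)).rank ≤ B.rank := by
  rw [borderMatrix_mulVec_eq B hB]
  exact (Matrix.rank_mul_le_right _ _).trans (Matrix.rank_mul_le_left _ _)

lemma rank_le_rank_borderMatrix : B.rank ≤ (borderMatrix B c d).rank := by
  conv_lhs => rw [← borderMatrix_submatrix_castSucc B c d]
  exact Matrix.rank_submatrix_le _ _ _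

lemma rank_borderMatrix_le : (borderMatrix B c d).rank ≤ B.rank + 2 := by
  have h : borderMatrix B c d =
      (identityAppend (0 : Fin n → ZMod 2))ᵀ * (B * identityAppend (0 : Fin n → ZMod 2)) +
        Matrix.vecMulVec (Pi.single (Fin.last n) 1) (Fin.snoc (α := fun _ => ZMod 2) c d) +
        Matrix.vecMulVec (Fin.snoc (α := fun _ => ZMod 2) c 0) (Pi.single (Fin.last n) 1) := by
    ext i j
    simp only [Matrix.add_apply, Matrix.vecMulVec_apply]
    refine Fin.lastCases ?_ (fun i => ?_) i <;> refine Fin.lastCases ?_ (fun j => ?_) j <;>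
      simp [Matrix.mul_apply, identityAppend, Matrix.one_apply]
  rw [h]
  refine (matrix_rank_add_le _ _).trans ?_
  have h1 := matrix_rank_add_le
    ((identityAppend (0 : Fin n → ZMod 2))ᵀ * (B * identityAppend (0 : Fin n → ZMod 2)))
    (Matrix.vecMulVec (Pi.single (Fin.last n) 1) (Fin.snoc (α := fun _ => ZMod 2) c d))
  have h2 := Matrix.rank_vecMulVec_le (Pi.single (Fin.last n) (1 : ZMod 2))
    (Fin.snoc (α := fun _ => ZMod 2) c d)
  have h3 := Matrix.rank_vecMulVec_le (Fin.snoc (α := fun _ => ZMod 2) c 0)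
    (Pi.single (Fin.last n) (1 : ZMod 2))
  have h4 := (Matrix.rank_mul_le_right (identityAppend (0 : Fin n → ZMod 2))ᵀ
    (B * identityAppend (0 : Fin n → ZMod 2))).trans (Matrix.rank_mul_le_left _ _)
  omega

lemma borderMatrix_eq_transpose (hB : B = Bᵀ) : borderMatrix B c d = (borderMatrix B c d)ᵀ := by
  ext i j
  rw [Matrix.transpose_apply]
  refine Fin.lastCases ?_ (fun i => ?_) i <;> refine Fin.lastCases ?_ (fun j => ?_) j <;> simp
  exact congr_fun₂ hB i j

/-- At least `2 ^ rank B` borders of a symmetric matrix `B` do not increase its rank. -/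
lemma two_pow_rank_le_card_borders (hB : B = Bᵀ) :
    2 ^ B.rank ≤ (Finset.univ.filter fun cd : (Fin n → ZMod 2) × ZMod 2 =>
      (borderMatrix B cd.1 cd.2).rank ≤ B.rank).card := by
  have hcard : 2 ^ B.rank = (Finset.univ.image B.mulVec).card := by
    have h := Module.card_eq_pow_finrank (K := ZMod 2) (V := LinearMap.range B.mulVecLin)
    rw [ZMod.card] at h
    rw [Matrix.rank, ← h, ← Set.ncard_coe_finset, Finset.coe_image, Finset.coe_univ,
      Set.image_univ, ← Nat.card_coe_set_eq, ← Nat.card_eq_fintype_card]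
    rfl
  rw [hcard]
  calc (Finset.univ.image B.mulVec).card
      ≤ ((Finset.univ.filter fun cd : (Fin n → ZMod 2) × ZMod 2 =>
          (borderMatrix B cd.1 cd.2).rank ≤ B.rank).image Prod.fst).card := by
        refine Finset.card_le_card fun y hy => ?_
        obtain ⟨x, -, rfl⟩ := Finset.mem_image.1 hy
        exact Finset.mem_image.2 ⟨(B *ᵥ x, x ⬝ᵥ B *ᵥ x),
          Finset.mem_filter.2 ⟨Finset.mem_univ _, rank_borderMatrix_mulVec_le B hB x⟩, rfl⟩
    _ ≤ _ := Finset.card_image_le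

lemma two_pow_rank_mul_le_sum_borders (hB : B = Bᵀ) (t : ℕ) (f : (Fin n → ZMod 2) × ZMod 2 → ℕ)
    (hf : ∀ cd : (Fin n → ZMod 2) × ZMod 2,
      (borderMatrix B cd.1 cd.2).rank ≤ B.rank → t ≤ f cd) :
    2 ^ B.rank * t ≤ ∑ cd, f cd := by
  refine (Nat.mul_le_mul_right t (two_pow_rank_le_card_borders B hB)).trans ?_
  rw [← smul_eq_mul]
  exact (Finset.card_nsmul_le_sum _ f t fun cd hcd => hf cd (Finset.mem_filter.1 hcd).2).trans
    (Finset.sum_le_sum_of_subset (Finset.filter_subset _ _))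

end borderMatrix

lemma card_borders (n : ℕ) : Fintype.card ((Fin n → ZMod 2) × ZMod 2) = 2 ^ (n + 1) := by
  simp [pow_succ, ZMod.card]

/-- Summing over symmetric matrices of size `n + 1` amounts to summing over borders of symmetric
matrices of size `n`. -/
lemma sum_symmetric_succ (n : ℕ) (f : Matrix (Fin (n + 1)) (Fin (n + 1)) (ZMod 2) → ℕ) :
    ∑ A with A = Aᵀ, f A =
      ∑ B : Matrix (Fin n) (Fin n) (ZMod 2) with B = Bᵀ,
        ∑ cd : (Fin n → ZMod 2) × ZMod 2, f (borderMatrix B cd.1 cd.2) := by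
  rw [← Finset.sum_product']
  refine (Finset.sum_bij (fun x _ => borderMatrix x.1 x.2.1 x.2.2) ?_ ?_ ?_ ?_).symm
  · intro x hx
    simp only [Finset.mem_product, Finset.mem_filter, Finset.mem_univ, true_and, and_true] at hx ⊢
    exact borderMatrix_eq_transpose _ _ _ hx
  · rintro ⟨B, c, d⟩ - ⟨B', c', d'⟩ - h
    simp only at h
    have hB : B = B' := by
      rw [← borderMatrix_submatrix_castSucc B c d, h, borderMatrix_submatrix_castSucc]
    have hc : c = c' := funext fun i => by
      rw [← borderMatrix_castSucc_last B c d, h, borderMatrix_castSucc_last]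
    have hd : d = d' := by
      rw [← borderMatrix_last_last B c d, h, borderMatrix_last_last]
    rw [hB, hc, hd]
  · intro A hA
    simp only [Finset.mem_filter, Finset.mem_univ, true_and] at hA
    refine ⟨(A.submatrix Fin.castSucc Fin.castSucc, fun i => A i.castSucc (Fin.last n),
      A (Fin.last n) (Fin.last n)), ?_, ?_⟩
    · simp only [Finset.mem_product, Finset.mem_filter, Finset.mem_univ, true_and, and_true]
      rw [Matrix.transpose_submatrix, ← hA]
    · ext i j
      refine Fin.lastCases ?_ (fun i => ?_) i <;> refine Fin.lastCases ?_ (fun j => ?_) j <;> simp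
      exact (congr_fun₂ hA _ _).symm
  · exact fun _ _ => rfl

/-- At least `1 / 64` of the two-fold borders of a symmetric `n × n` matrix have rank at
most `n`. -/
lemma two_pow_le_sum_borders {n : ℕ} (B : Matrix (Fin n) (Fin n) (ZMod 2)) (hB : B = Bᵀ) :
    2 ^ (2 * n) ≤ 8 * ∑ cd : (Fin n → ZMod 2) × ZMod 2,
      (Finset.univ.filter fun cd' : (Fin (n + 1) → ZMod 2) × ZMod 2 =>
        (borderMatrix (borderMatrix B cd.1 cd.2) cd'.1 cd'.2).rank ≤ n).card := by
  have hr : B.rank ≤ n := by simpa using B.rank_le_width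
  have full (cd : (Fin n → ZMod 2) × ZMod 2) (hcd : (borderMatrix B cd.1 cd.2).rank + 2 ≤ n) :
      2 ^ (n + 2) = (Finset.univ.filter fun cd' : (Fin (n + 1) → ZMod 2) × ZMod 2 =>
        (borderMatrix (borderMatrix B cd.1 cd.2) cd'.1 cd'.2).rank ≤ n).card := by
    rw [Finset.filter_true_of_mem fun cd' _ => (rank_borderMatrix_le _ _ _).trans hcd,
      Finset.card_univ, card_borders]
  rcases le_or_gt n (B.rank + 1) with h1 | h1
  · refine le_trans ?_ (Nat.mul_le_mul_left 8
      (two_pow_rank_mul_le_sum_borders B hB (2 ^ B.rank) _ fun cd hcd => ?_))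
    · calc 2 ^ (2 * n) ≤ 2 ^ (3 + (B.rank + B.rank)) := Nat.pow_le_pow_right two_pos (by omega)
        _ = _ := by rw [pow_add, pow_add]; norm_num
    · refine (Nat.pow_le_pow_right two_pos (rank_le_rank_borderMatrix B cd.1 cd.2)).trans
        ((two_pow_rank_le_card_borders _ (borderMatrix_eq_transpose B cd.1 cd.2 hB)).trans
          (Finset.card_le_card ?_))
      exact Finset.monotone_filter_right _ fun cd' _ hcd' => hcd'.trans (hcd.trans hr)
  rcases le_or_gt n (B.rank + 3) with h2 | h2
  · have h := two_pow_rank_mul_le_sum_borders B hB (2 ^ (n + 2)) _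
      fun cd hcd => (full cd (by omega)).le
    refine le_trans ?_ (Nat.mul_le_mul_left 8 h)
    calc 2 ^ (2 * n) ≤ 2 ^ (3 + (B.rank + (n + 2))) := Nat.pow_le_pow_right two_pos (by omega)
      _ = _ := by rw [pow_add 2 3, pow_add 2 B.rank]; norm_num
  · rw [Finset.sum_congr rfl fun cd _ => (full cd (by
      have := rank_borderMatrix_le B cd.1 cd.2
      omega)).symm, Finset.sum_const, Finset.card_univ, card_borders, smul_eq_mul, ← pow_add]
    exact (Nat.pow_le_pow_right two_pos (by omega)).trans (Nat.le_mul_of_pos_left _ (by norm_num))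

lemma card_symmetric_le (n : ℕ) :
    (Finset.univ.filter fun A : Matrix (Fin (n + 2)) (Fin (n + 2)) (ZMod 2) => A = Aᵀ).card ≤
      64 * ∑ A : Matrix (Fin (n + 2)) (Fin (n + 2)) (ZMod 2) with A = Aᵀ,
        if A.rank ≤ n then 1 else 0 := by
  rw [Finset.card_eq_sum_ones, sum_symmetric_succ, sum_symmetric_succ, sum_symmetric_succ,
    sum_symmetric_succ, Finset.mul_sum]
  refine Finset.sum_le_sum fun B hB => ?_
  have h := two_pow_le_sum_borders B (Finset.mem_filter.1 hB).2
  simp only [Finset.card_filter] at h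
  simp only [Finset.card_univ, card_borders, Finset.sum_const, smul_eq_mul]
  calc 2 ^ (n + 1) * (2 ^ (n + 1 + 1) * 1) = 8 * 2 ^ (2 * n) := by ring
    _ ≤ 8 * (8 * _) := Nat.mul_le_mul_left 8 h
    _ = _ := by rw [← mul_assoc]; norm_num

theorem statement19 (k : ℕ) (hk : 4 ≤ k) :
    ((Finset.univ.filter fun A : Matrix (Fin k) (Fin k) (ZMod 2) =>
        A = Aᵀ ∧
          (A.submatrix (fun i : Fin (k-1) => Fin.castLE (Nat.sub_le k 1) i)
            (fun j : Fin (k-1) => Fin.castLE (Nat.sub_le k 1) j)).rank ≤ k - 3).card : ℝ) /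
      ((Finset.univ.filter fun A : Matrix (Fin k) (Fin k) (ZMod 2) =>
        A = Aᵀ).card : ℝ) ≥ (2:ℝ) ^ (-6 : ℤ) := by
  obtain ⟨n, rfl⟩ : ∃ n, k = n + 3 := ⟨k - 3, by omega⟩
  have hnum : (Finset.univ.filter fun A : Matrix (Fin (n + 3)) (Fin (n + 3)) (ZMod 2) =>
      A = Aᵀ ∧ (A.submatrix (fun i : Fin (n + 3 - 1) => Fin.castLE (Nat.sub_le (n + 3) 1) i)
        (fun j : Fin (n + 3 - 1) => Fin.castLE (Nat.sub_le (n + 3) 1) j)).rank ≤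
          n + 3 - 3).card =
      2 ^ (n + 3) * ∑ A : Matrix (Fin (n + 2)) (Fin (n + 2)) (ZMod 2) with A = Aᵀ,
        if A.rank ≤ n then 1 else 0 := by
    rw [← Finset.filter_filter, Finset.card_filter, sum_symmetric_succ, Finset.mul_sum]
    refine Finset.sum_congr rfl fun B _ => ?_
    rw [← card_borders, ← Finset.card_univ, ← smul_eq_mul, ← Finset.sum_const]
    refine Finset.sum_congr rfl fun cd _ => ?_
    conv_rhs => rw [← borderMatrix_submatrix_castSucc B cd.1 cd.2]
    rfl
  have hden : (Finset.univ.filter fun A : Matrix (Fin (n + 3)) (Fin (n + 3)) (ZMod 2) =>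
      A = Aᵀ).card = 2 ^ (n + 3) *
        (Finset.univ.filter fun A : Matrix (Fin (n + 2)) (Fin (n + 2)) (ZMod 2) =>
          A = Aᵀ).card := by
    rw [Finset.card_eq_sum_ones, sum_symmetric_succ]
    simp only [Finset.card_univ, card_borders, Finset.sum_const, smul_eq_mul, mul_one]
    exact mul_comm _ _
  have hpos : 0 < (Finset.univ.filter fun A : Matrix (Fin (n + 3)) (Fin (n + 3)) (ZMod 2) =>
      A = Aᵀ).card :=
    Finset.card_pos.2 ⟨0, by simp⟩
  have hle := Nat.mul_le_mul_left (2 ^ (n + 3)) (card_symmetric_le n)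
  rw [← hden, mul_left_comm, ← hnum] at hle
  rw [ge_iff_le, le_div_iff₀ (by exact_mod_cast hpos)]
  have hle' := (Nat.cast_le (α := ℝ)).2 hle
  rw [Nat.cast_mul] at hle'
  norm_num at hle' ⊢
  linarith

end
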